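/- Suppose there are N ≥ 1 agents, each agent i having a slope parameter β_i > 0 and an intercept parameter α_i ∈ ℝ, and let the transmission efficiency satisfy 0 < γ ≤ 1. Define each agent's supply function μ_i⁺(p) := max(β_i p − α_i, 0) and demand function μ_i⁻(p) := max(α_i − β_i p, 0), and the aggregate excess-supply function F(p) := γ · Σ_{i=1}^N μ_i⁺(p) − Σ_{i=1}^N μ_i⁻(p). If γ · Σ_{i=1}^N max(−α_i, 0) < Σ_{i=1}^N max(α_i, 0) (i.e., F(0) < 0), then there exists a unique p ∈ ℝ with F(p) = 0, and moreover this clearing price p is strictly positive. -/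

import Mathlib

open Finset

/-- The excess supply of one agent, as a function of its net position, is strictly increasing. -/
theorem strictMono_mul_posPart_sub_negPart {γ : ℝ} (hγ : 0 < γ) :
    StrictMono fun x : ℝ => γ * max x 0 - max (-x) 0 := by
  intro x y hxy
  dsimp only
  rcases le_total x 0 with hx | hx <;> rcases le_total y 0 with hy | hy
  · rw [max_eq_right hx, max_eq_right hy, max_eq_left (by linarith), max_eq_left (by linarith)]
    linarith
  · rw [max_eq_right hx, max_eq_left hy, max_eq_left (by linarith), max_eq_right (by linarith)]
    rcases hy.eq_or_lt with rfl | hy'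
    · linarith
    · nlinarith [mul_pos hγ hy']
  · linarith
  · rw [max_eq_left hx, max_eq_left hy, max_eq_right (by linarith), max_eq_right (by linarith)]
    linarith [mul_lt_mul_of_pos_left hxy hγ]

/-- With `N ≥ 1` agents having slopes `β i > 0` and intercepts `α i`,
transmission efficiency `0 < γ ≤ 1`, and aggregate excess-supply function
`F p = γ * Σ max(β i * p - α i, 0) - Σ max(α i - β i * p, 0)`, if `F 0 < 0`
(i.e. `γ * Σ max(-α i,0) < Σ max(α i,0)`), then there exists a unique clearing price
`p` with `F p = 0`, and every such clearing price is strictly positive. -/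
theorem lfsda_clearing_price_exists_unique_pos
    (N : ℕ) (hN : 1 ≤ N) (α β : Fin N → ℝ) (hβ : ∀ i, 0 < β i)
    (γ : ℝ) (hγ0 : 0 < γ) (hγ1 : γ ≤ 1)
    (F : ℝ → ℝ)
    (hF : ∀ p : ℝ, F p = γ * ∑ i, max (β i * p - α i) 0 - ∑ i, max (α i - β i * p) 0)
    (h0 : γ * ∑ i, max (-α i) 0 < ∑ i, max (α i) 0) :
    (∃! p : ℝ, F p = 0) ∧ ∀ p : ℝ, F p = 0 → 0 < p := by
  have hne : (univ : Finset (Fin N)).Nonempty := ⟨⟨0, hN⟩, mem_univ _⟩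
  have hmono : StrictMono F := by
    intro p q hpq
    simp only [hF, mul_sum, ← sum_sub_distrib]
    refine sum_lt_sum_of_nonempty hne fun i _ => ?_
    have hlt : β i * p - α i < β i * q - α i :=
      sub_lt_sub_right (mul_lt_mul_of_pos_left hpq (hβ i)) _
    simpa only [neg_sub] using strictMono_mul_posPart_sub_negPart hγ0 hlt
  have hcont : Continuous F := by
    rw [funext hF]
    fun_prop
  have hF0 : F 0 < 0 := by
    rw [hF]
    simpa using h0
  obtain ⟨P, hP0, hP⟩ : ∃ P : ℝ, 0 ≤ P ∧ 0 ≤ F P := by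
    have hnonneg : ∀ i ∈ univ, 0 ≤ |α i| / β i := fun i _ => div_nonneg (abs_nonneg _) (hβ i).le
    refine ⟨∑ i, |α i| / β i, sum_nonneg hnonneg, ?_⟩
    have hdemand : ∀ i, max (α i - β i * ∑ j, |α j| / β j) 0 = 0 := by
      intro i
      refine max_eq_right (sub_nonpos.2 ((le_abs_self _).trans ?_))
      rw [← div_le_iff₀' (hβ i)]
      exact single_le_sum hnonneg (mem_univ i)
    simp only [hF, hdemand, sum_const_zero, sub_zero]
    exact mul_nonneg hγ0.le (sum_nonneg fun i _ => le_max_right _ _)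
  obtain ⟨p, -, hp⟩ := intermediate_value_Icc hP0 hcont.continuousOn ⟨hF0.le, hP⟩
  exact ⟨⟨p, hp, fun q hq => hmono.injective (hq.trans hp.symm)⟩,
    fun q hq => hmono.lt_iff_lt.1 (hF0.trans_eq hq.symm)⟩
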